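/- arXiv:2303.09898 — 6 statements merged into one kernel-verified Lean document; each statement's English description precedes it below -/
import Mathlib

section
/- For any two binary words u and v of the same length and any symbol a ∈ {0,1}, appending a to both words preserves the tilde-distance: dist~(ua, va) = dist~(u, v). -/
/-- One tilde edit step: a replacement (flip one symbol) or a swap of two
adjacent distinct symbols. -/
inductive TStep : List Bool → List Bool → Prop
  | repl (x y : List Bool) (a : Bool) : TStep (x ++ a :: y) (x ++ (!a) :: y)
  | swap (x y : List Bool) (a : Bool) : TStep (x ++ a :: (!a) :: y) (x ++ (!a) :: a :: y)

/-- `reach step h u v` : `v` can be obtained from `u` by a chain of `h` steps. -/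
def reach (step : List Bool → List Bool → Prop) : ℕ → List Bool → List Bool → Prop
  | 0 => Eq
  | h + 1 => fun u v => ∃ w, step u w ∧ reach step h w v

/-- The tilde-distance: the minimum number of replacements and swaps needed to
transform `u` into `v`. -/
noncomputable def tildeDist (u v : List Bool) : ℕ := sInf {h | reach TStep h u v}

theorem TStep.symm {u v : List Bool} (h : TStep u v) : TStep v u := by
  cases h with
  | repl x y a => simpa using TStep.repl x y (!a)
  | swap x y a => simpa using TStep.swap x y (!a)

theorem reach_snoc {step : List Bool → List Bool → Prop} :
    ∀ {h : ℕ} {u v w : List Bool}, reach step h u v → step v w → reach step (h + 1) u w := by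
  intro h
  induction h with
  | zero => intro u v w r s; exact ⟨w, r ▸ s, rfl⟩
  | succ h ih => intro u v w r s; obtain ⟨z, su, rz⟩ := r; exact ⟨z, su, ih rz s⟩

theorem reach_symm : ∀ {h : ℕ} {u v : List Bool}, reach TStep h u v → reach TStep h v u := by
  intro h
  induction h with
  | zero => intro u v r; exact r.symm
  | succ h ih => intro u v r; obtain ⟨w, s, rw⟩ := r; exact reach_snoc (ih rw) s.symm

theorem tildeDist_comm (u v : List Bool) : tildeDist u v = tildeDist v u := by
  unfold tildeDist
  congr 1
  ext h
  exact ⟨fun r => reach_symm r, fun r => reach_symm r⟩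

theorem tildeDist_self (u : List Bool) : tildeDist u u = 0 :=
  Nat.sInf_eq_zero.mpr (Or.inl rfl)

/-- The Hamming distance: the number of positions at which `u` and `v` differ. -/
def hammDist (u v : List Bool) : ℕ := ((u.zip v).filter fun p => p.1 != p.2).length

theorem hammDist_comm : ∀ u v : List Bool, hammDist u v = hammDist v u
  | [], [] => rfl
  | [], _ :: _ => rfl
  | _ :: _, [] => rfl
  | a :: u, b :: v => by
    cases a <;> cases b <;>
      simp [hammDist, List.filter_cons, hammDist_comm u v, hammDist] <;>
      simpa [hammDist] using hammDist_comm u v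

theorem hammDist_self : ∀ u : List Bool, hammDist u u = 0
  | [] => rfl
  | a :: u => by simpa [hammDist, List.filter_cons] using hammDist_self u

/-- Binary words of length `n`. -/
abbrev Word (n : ℕ) := {w : List Bool // w.length = n}

/-- The `n`-tilde-hypercube: vertices are the binary words of length `n`, and
two vertices are adjacent iff their tilde-distance is `1`. -/
noncomputable def tildeCube (n : ℕ) : SimpleGraph (Word n) where
  Adj u v := tildeDist u.val v.val = 1
  symm := ⟨by intro u v h; rwa [tildeDist_comm]⟩
  loopless := ⟨by intro u h; rw [tildeDist_self] at h; exact one_ne_zero h.symm⟩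

/-- The `n`-hypercube: vertices are the binary words of length `n`, and
two vertices are adjacent iff their Hamming distance is `1`. -/
def hamCube (n : ℕ) : SimpleGraph (Word n) where
  Adj u v := hammDist u.val v.val = 1
  symm := ⟨by intro u v h; rwa [hammDist_comm]⟩
  loopless := ⟨by intro u h; rw [hammDist_self] at h; exact one_ne_zero h.symm⟩

/-- `f` is tilde-isometric. -/
def TildeIsometric (f : List Bool) : Prop :=
  ∀ n : ℕ, f.length ≤ n → ∀ u v : List Bool, u.length = n → v.length = n →
    ¬ f <:+: u → ¬ f <:+: v →
    ∃ w : ℕ → List Bool, w 0 = u ∧ w (tildeDist u v) = v ∧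
      (∀ k < tildeDist u v, tildeDist (w k) (w (k + 1)) = 1) ∧
      (∀ k ≤ tildeDist u v, ¬ f <:+: w k)

/-- `f` is Ham-isometric. -/
def HamIsometric (f : List Bool) : Prop :=
  ∀ u v : List Bool, u.length = v.length →
    ¬ f <:+: u → ¬ f <:+: v →
    ∃ w : ℕ → List Bool, w 0 = u ∧ w (hammDist u v) = v ∧
      (∀ k ≤ hammDist u v, (w k).length = u.length) ∧
      (∀ k < hammDist u v, hammDist (w k) (w (k + 1)) = 1) ∧
      (∀ k ≤ hammDist u v, ¬ f <:+: w k)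
/-- The set of words of length `n` avoiding the factor `11`. -/
def fibFree (n : ℕ) : Set (Word n) := {w | ¬ [true, true] <:+: w.val}

/-- The `n`-tilde-Fibonacci cube: the subgraph of the tilde-hypercube induced by
the words avoiding the factor `11`. -/
noncomputable def tildeFibCube (n : ℕ) : SimpleGraph (fibFree n) :=
  (tildeCube n).induce (fibFree n)

/-- The `n`-Fibonacci cube: the subgraph of the hypercube induced by
the words avoiding the factor `11`. -/
def fibCube (n : ℕ) : SimpleGraph (fibFree n) :=
  (hamCube n).induce (fibFree n)


theorem TStep.dropLast_aux {u w : List Bool} (s : TStep u w) :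
    u.dropLast = w.dropLast ∨ TStep u.dropLast w.dropLast := by
  cases s with
  | repl x y a =>
    rcases List.eq_nil_or_concat y with rfl | ⟨y, b, rfl⟩
    · left; simp
    · right
      have h := TStep.repl x y a
      have e : ∀ c : Bool, (x ++ c :: (y ++ [b])).dropLast = x ++ c :: y := by
        intro c
        rw [show x ++ c :: (y ++ [b]) = (x ++ c :: y) ++ [b] by simp, List.dropLast_concat]
      simpa only [List.concat_eq_append, e] using h
  | swap x y a =>
    right
    rcases List.eq_nil_or_concat y with rfl | ⟨y, b, rfl⟩
    · have h := TStep.repl x [] a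
      have e : ∀ c d : Bool, (x ++ [c, d]).dropLast = x ++ [c] := by
        intro c d
        rw [show x ++ [c, d] = (x ++ [c]) ++ [d] by simp, List.dropLast_concat]
      simpa only [e] using h
    · have h := TStep.swap x y a
      have e : ∀ c d : Bool, (x ++ c :: d :: (y ++ [b])).dropLast = x ++ c :: d :: y := by
        intro c d
        rw [show x ++ c :: d :: (y ++ [b]) = (x ++ c :: d :: y) ++ [b] by simp,
          List.dropLast_concat]
      simpa only [List.concat_eq_append, e] using h

theorem reach_dropLast_aux : ∀ (n : ℕ) (u v : List Bool), reach TStep n u v →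
    ∃ k ≤ n, reach TStep k u.dropLast v.dropLast := by
  intro n
  induction n with
  | zero => intro u v r; exact ⟨0, le_rfl, congrArg List.dropLast r⟩
  | succ n ih =>
    rintro u v ⟨w, s, r⟩
    obtain ⟨k, hk, r'⟩ := ih w v r
    rcases s.dropLast_aux with e | s'
    · exact ⟨k, by omega, e ▸ r'⟩
    · exact ⟨k + 1, by omega, _, s', r'⟩

theorem TStep.append_aux {u w : List Bool} (s : TStep u w) (z : List Bool) :
    TStep (u ++ z) (w ++ z) := by
  cases s with
  | repl x y a => simpa using TStep.repl x (y ++ z) a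
  | swap x y a => simpa using TStep.swap x (y ++ z) a

theorem reach_append_aux (z : List Bool) : ∀ (n : ℕ) (u v : List Bool), reach TStep n u v →
    reach TStep n (u ++ z) (v ++ z) := by
  intro n
  induction n with
  | zero => intro u v r; exact congrArg (· ++ z) r
  | succ n ih =>
    rintro u v ⟨w, s, r⟩
    exact ⟨_, s.append_aux z, ih w v r⟩

/-- Appending the same symbol to two words of the same length preserves the
tilde-distance. -/
theorem tildeDist_append_singleton (u v : List Bool) (h : u.length = v.length) (a : Bool) :
    tildeDist (u ++ [a]) (v ++ [a]) = tildeDist u v := by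
  unfold tildeDist
  have key : ∀ n, reach TStep n (u ++ [a]) (v ++ [a]) → ∃ k ≤ n, reach TStep k u v := by
    intro n r
    simpa only [List.dropLast_concat] using reach_dropLast_aux n _ _ r
  rcases Set.eq_empty_or_nonempty {n | reach TStep n u v} with he | hne
  · have he' : {n | reach TStep n (u ++ [a]) (v ++ [a])} = ∅ := by
      ext n
      simp only [Set.mem_setOf_eq, Set.mem_empty_iff_false, iff_false]
      intro r
      obtain ⟨k, _, r'⟩ := key n r
      have : k ∈ {n | reach TStep n u v} := r'
      rw [he] at this
      exact this
    rw [he, he']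
  · have h1 : reach TStep (sInf {n | reach TStep n u v}) u v := Nat.sInf_mem hne
    have h2 := reach_append_aux [a] _ _ _ h1
    apply le_antisymm
    · exact Nat.sInf_le h2
    · have h3 : reach TStep (sInf {n | reach TStep n (u ++ [a]) (v ++ [a])}) (u ++ [a]) (v ++ [a]) :=
        Nat.sInf_mem (s := {n | reach TStep n (u ++ [a]) (v ++ [a])}) ⟨_, h2⟩
      obtain ⟨k, hk, r⟩ := key _ h3
      exact (Nat.sInf_le r).trans hk
end

section
/- For binary words u and v of the same length, dist~(u0, v1) = 1 if and only if either u = v, or there exists a binary word w such that u = w1 and v = w0. (This characterizes all edges between the '0-copy' and the '1-copy' in the recursive construction of the tilde-hypercube.) -/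
/-- Characterization of the edges between the `0`-copy and the `1`-copy in the
recursive construction of the tilde-hypercube. -/
theorem tildeDist_zero_one_copy (u v : List Bool) (h : u.length = v.length) :
    tildeDist (u ++ [false]) (v ++ [true]) = 1 ↔
      u = v ∨ ∃ w : List Bool, u = w ++ [true] ∧ v = w ++ [false] := by
  have key : tildeDist (u ++ [false]) (v ++ [true]) = 1 ↔
      TStep (u ++ [false]) (v ++ [true]) := by
    constructor
    · intro hd
      have hne : {h | reach TStep h (u ++ [false]) (v ++ [true])}.Nonempty := by
        apply Nat.nonempty_of_pos_sInf
        unfold tildeDist at hd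
        omega
      have hm := Nat.sInf_mem hne
      unfold tildeDist at hd
      rw [hd] at hm
      obtain ⟨w, hs, hw⟩ := hm
      have hw' : w = v ++ [true] := hw
      exact hw' ▸ hs
    · intro hs
      have h1 : tildeDist (u ++ [false]) (v ++ [true]) ≤ 1 :=
        Nat.sInf_le ⟨_, hs, rfl⟩
      have h0 : tildeDist (u ++ [false]) (v ++ [true]) ≠ 0 := by
        intro h0
        rcases Nat.sInf_eq_zero.mp h0 with h0 | h0
        · have h2 : u ++ [false] = v ++ [true] := h0
          have h3 := congrArg List.getLast? h2
          simp at h3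
        · have h2 : (1 : ℕ) ∈ {h | reach TStep h (u ++ [false]) (v ++ [true])} :=
            ⟨_, hs, rfl⟩
          rw [h0] at h2
          exact h2
      omega
  rw [key]
  constructor
  · intro hs
    generalize hp : u ++ [false] = p at hs
    generalize hq : v ++ [true] = q at hs
    cases hs with
    | repl x y a =>
      left
      rcases List.eq_nil_or_concat y with rfl | ⟨z, b, rfl⟩
      · have h1 := (List.append_inj' hp rfl).1
        have h2 := (List.append_inj' hq rfl).1
        rw [h1, h2]
      · have h1 := congrArg List.getLast? hp
        have h2 := congrArg List.getLast? hq
        simp [List.getLast?_append, List.getLast?_cons] at h1 h2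
        grind
    | swap x y a =>
      right
      rcases List.eq_nil_or_concat y with rfl | ⟨z, b, rfl⟩
      · have h1 := List.append_inj' (s₁ := u) (s₂ := x ++ [a]) (t₁ := [false]) (t₂ := [!a])
          (by simpa using hp) rfl
        have h2 := List.append_inj' (s₁ := v) (s₂ := x ++ [!a]) (t₁ := [true]) (t₂ := [a])
          (by simpa using hq) rfl
        have ha : a = true := by simpa using h2.2.symm
        subst ha
        exact ⟨x, h1.1, h2.1⟩
      · have h1 := congrArg List.getLast? hp
        have h2 := congrArg List.getLast? hq
        simp [List.getLast?_append, List.getLast?_cons] at h1 h2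
        grind
  · rintro (rfl | ⟨w, rfl, rfl⟩)
    · exact TStep.repl u [] false
    · simpa using TStep.swap w [] true
end

section
/- The number of edges of the tilde-hypercube satisfies the recurrence |E(Q̃_1)| = 1 and, for all n ≥ 2, |E(Q̃_n)| = 2·|E(Q̃_{n-1})| + 2^{n-1} + 2^{n-2}. -/
theorem tstep_length {u v : List Bool} (h : TStep u v) : u.length = v.length := by
  cases h <;> simp

theorem tstep_ne {u v : List Bool} (h : TStep u v) : u ≠ v := by
  cases h <;> simp

theorem tildeDist_one_iff (u v : List Bool) : tildeDist u v = 1 ↔ TStep u v := by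
  have h1 : reach TStep 1 u v ↔ TStep u v := by
    constructor
    · rintro ⟨w, hw, rfl⟩; exact hw
    · intro h; exact ⟨v, h, rfl⟩
  unfold tildeDist
  constructor
  · intro h
    have hne : {h | reach TStep h u v}.Nonempty := Nat.nonempty_of_sInf_eq_succ h
    have := Nat.sInf_mem hne
    rw [h] at this
    exact h1.1 this
  · intro h
    have hm : 1 ∈ {h | reach TStep h u v} := h1.2 h
    have hle := Nat.sInf_le hm
    have h0 : sInf {h | reach TStep h u v} ≠ 0 := by
      intro h0
      have := Nat.sInf_mem ⟨1, hm⟩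
      rw [h0] at this
      exact tstep_ne h this
    omega

theorem TStep.cons {u v : List Bool} (a : Bool) (h : TStep u v) : TStep (a :: u) (a :: v) := by
  cases h with
  | repl x y b => exact TStep.repl (a :: x) y b
  | swap x y b => exact TStep.swap (a :: x) y b

/-- Swap at the head. -/
def swp (a : Bool) : List Bool → Finset (List Bool)
  | [] => ∅
  | b :: y => if b = !a then {b :: a :: y} else ∅

/-- Neighbours. -/
def nbr : List Bool → Finset (List Bool)
  | [] => ∅
  | a :: u => (nbr u).map ⟨List.cons a, List.cons_injective⟩ ∪ ({(!a) :: u} ∪ swp a u)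

theorem mem_nbr (u : List Bool) : ∀ v, v ∈ nbr u ↔ TStep u v := by
  induction u with
  | nil =>
    intro v
    simp only [nbr, Finset.notMem_empty, false_iff]
    intro h
    generalize hz : ([] : List Bool) = z at h
    cases h <;> simp at hz
  | cons a u ih =>
    intro v
    simp only [nbr, Finset.mem_union, Finset.mem_map, Finset.mem_singleton,
      Function.Embedding.coeFn_mk, ih]
    constructor
    · rintro (⟨w, hw, rfl⟩ | rfl | h)
      · exact hw.cons a
      · exact TStep.repl [] u a
      · cases u with
        | nil => simp [swp] at h
        | cons b y =>
          simp only [swp] at h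
          split_ifs at h with hb
          · simp only [Finset.mem_singleton] at h
            subst h hb
            exact TStep.swap [] y a
          · simp at h
    · intro h
      generalize hz : a :: u = z at h
      cases h with
      | repl x y b =>
        cases x with
        | nil => simp at hz; obtain ⟨rfl, rfl⟩ := hz; right; left; rfl
        | cons c x =>
          simp at hz; obtain ⟨rfl, rfl⟩ := hz
          left; exact ⟨_, TStep.repl x y b, rfl⟩
      | swap x y b =>
        cases x with
        | nil => simp at hz; obtain ⟨rfl, rfl⟩ := hz; right; right; simp [swp]
        | cons c x =>
          simp at hz; obtain ⟨rfl, rfl⟩ := hz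
          left; exact ⟨_, TStep.swap x y b, rfl⟩

theorem card_nbr_cons (a : Bool) (u : List Bool) :
    (nbr (a :: u)).card = (nbr u).card + 1 + (swp a u).card := by
  rw [nbr, Finset.card_union_of_disjoint, Finset.card_union_of_disjoint, Finset.card_map,
    Finset.card_singleton, add_assoc]
  · cases u with
    | nil => simp [swp]
    | cons b y => simp only [swp]; split_ifs with h <;> simp [h]
  · rw [Finset.disjoint_left]
    intro v hv
    simp only [Finset.mem_map, Function.Embedding.coeFn_mk] at hv
    obtain ⟨w, _, rfl⟩ := hv
    cases u with
    | nil => simp [swp]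
    | cons b y => simp only [swp]; split_ifs with h <;> simp [h]

instance wordFintype (n : ℕ) : Fintype (Word n) :=
  inferInstanceAs (Fintype (List.Vector Bool n))

theorem card_word (n : ℕ) : Fintype.card (Word n) = 2 ^ n := by
  have h : Fintype.card (Word n) = Fintype.card Bool ^ n := card_vector (α := Bool) n
  rw [h, Fintype.card_bool]

/-- Decomposition of words. -/
def wordCons (n : ℕ) : Bool × Word n ≃ Word (n + 1) where
  toFun p := ⟨p.1 :: p.2.1, by simp [p.2.2]⟩
  invFun w := ⟨w.1.head (by rintro h; have := w.2; simp [h] at this),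
    ⟨w.1.tail, by simp [w.2]⟩⟩
  left_inv p := by simp
  right_inv w := by simp

theorem sum_word_succ (n : ℕ) (f : List Bool → ℕ) :
    ∑ w : Word (n + 1), f w.1 = ∑ a : Bool, ∑ w : Word n, f (a :: w.1) := by
  rw [← (wordCons n).sum_comp, Fintype.sum_prod_type]
  rfl

theorem two_mul_edges (n : ℕ) :
    2 * Nat.card (tildeCube n).edgeSet = ∑ w : Word n, (nbr w.1).card := by
  classical
  rw [Nat.card_eq_fintype_card, ← SimpleGraph.edgeFinset_card,
    ← SimpleGraph.sum_degrees_eq_twice_card_edges]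
  refine Finset.sum_congr rfl fun w _ => ?_
  rw [← SimpleGraph.card_neighborFinset_eq_degree,
    ← Finset.card_map (Function.Embedding.subtype _)]
  congr 1
  ext v
  simp only [Finset.mem_map, SimpleGraph.mem_neighborFinset, Function.Embedding.subtype_apply,
    mem_nbr]
  constructor
  · rintro ⟨x, hx, rfl⟩
    exact (tildeDist_one_iff _ _).1 hx
  · intro h
    exact ⟨⟨v, (tstep_length h).symm.trans w.2⟩, (tildeDist_one_iff _ _).2 h, rfl⟩

theorem sum_nbr_succ (n : ℕ) : ∑ w : Word (n + 1), (nbr w.1).card =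
    2 * ∑ w : Word n, (nbr w.1).card + 2 * 2 ^ n
      + ∑ a : Bool, ∑ w : Word n, (swp a w.1).card := by
  rw [sum_word_succ n (fun w => (nbr w).card)]
  simp only [card_nbr_cons, Finset.sum_add_distrib, Fintype.sum_bool, Finset.sum_const,
    Finset.card_univ, card_word, smul_eq_mul, Fintype.card_bool]
  ring

theorem sum_swp (n : ℕ) :
    ∑ a : Bool, ∑ w : Word (n + 1), (swp a w.1).card = 2 * 2 ^ n := by
  have h (a : Bool) := sum_word_succ n (fun w => (swp a w).card)
  simp only [h]
  simp [swp, card_word]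
  try ring

/-- Recurrence for the number of edges of the tilde-hypercube. -/
theorem tildeCube_edge_recurrence :
    Nat.card (tildeCube 1).edgeSet = 1 ∧
    ∀ n : ℕ, 2 ≤ n →
      Nat.card (tildeCube n).edgeSet =
        2 * Nat.card (tildeCube (n - 1)).edgeSet + 2 ^ (n - 1) + 2 ^ (n - 2) := by
  constructor
  · have h := two_mul_edges 1
    have hw : ∀ w : Word 0, w.1 = [] := fun w => List.length_eq_zero_iff.1 w.2
    have h2 := sum_nbr_succ 0
    simp only [hw, nbr, swp, Finset.card_empty, Finset.sum_const_zero] at h2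
    have h3 : ∑ w : Word 1, (nbr w.1).card = 2 := h2
    omega
  · intro n hn
    obtain ⟨m, rfl⟩ := Nat.exists_eq_add_of_le' hn
    have h := two_mul_edges (m + 2)
    have h' := two_mul_edges (m + 1)
    rw [sum_nbr_succ (m + 1), sum_swp, ← h'] at h
    change _ = 2 * Nat.card (tildeCube (m + 1)).edgeSet + 2 ^ (m + 1) + 2 ^ m
    omega
end

section
/- A binary word of length 4 is tilde-isometric if and only if it belongs to the set {1111, 1110, 1000, 0000, 0001, 0111}; in particular, 1100, 1010, 1001, 1011 and their complements and reverses are tilde-non-isometric. -/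
namespace TI

/-- Greedy left-to-right computation of the tilde-distance. -/
def D : List Bool → List Bool → ℕ
  | a :: c :: u, b :: e :: v =>
    if a = b then D (c :: u) (e :: v)
    else if c = b ∧ e = a then 1 + D u v else 1 + D (c :: u) (e :: v)
  | [a], [b] => if a = b then 0 else 1
  | _, _ => 0

lemma D_mono : ∀ (n : ℕ) (u v : List Bool), u.length = n → v.length = n → ∀ a b : Bool,
    D u v ≤ D (a :: u) (b :: v) ∧ D (a :: u) (b :: v) ≤ 1 + D u v := by
  intro n
  induction n with
  | zero =>
    intro u v hu hv a b
    rw [List.length_eq_zero_iff] at hu hv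
    subst hu hv
    cases a <;> cases b <;> simp [D]
  | succ n ih =>
    intro u v hu hv a b
    match u, v, hu, hv with
    | c :: u, e :: v, hu, hv =>
      have := ih u v (by simpa using hu) (by simpa using hv) c e
      rw [D]
      split_ifs <;> omega

lemma D_cons_same (a : Bool) {u v : List Bool} (h : u.length = v.length) :
    D (a :: u) (a :: v) = D u v := by
  match u, v, h with
  | [], [], _ => simp [D]
  | c :: u, e :: v, _ => simp [D]

lemma D_self : ∀ u : List Bool, D u u = 0
  | [] => rfl
  | a :: u => by rw [D_cons_same a rfl, D_self u]

/-- Recursive version of `TStep`. -/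
inductive S : List Bool → List Bool → Prop
  | repl (a : Bool) (y : List Bool) : S (a :: y) ((!a) :: y)
  | swap (a : Bool) (y : List Bool) : S (a :: (!a) :: y) ((!a) :: a :: y)
  | cons (a : Bool) {u w : List Bool} : S u w → S (a :: u) (a :: w)

lemma S_of {u w : List Bool} (h : TStep u w) : S u w := by
  cases h with
  | repl x y a =>
    induction x with
    | nil => exact S.repl a y
    | cons b x ih => exact S.cons b ih
  | swap x y a =>
    induction x with
    | nil => exact S.swap a y
    | cons b x ih => exact S.cons b ih

lemma S_len {u w : List Bool} (h : S u w) : u.length = w.length := by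
  induction h <;> simp_all

lemma S_ne {u w : List Bool} (h : S u w) : u ≠ w := by
  induction h <;> simp_all

lemma D_lip {u w : List Bool} (h : S u w) :
    ∀ v : List Bool, u.length = v.length → D u v ≤ 1 + D w v := by
  induction h with
  | repl a y =>
    intro v hv
    match v, hv with
    | b :: v, hv =>
      have hv' : y.length = v.length := by simpa using hv
      have h1 := D_mono _ y v hv' rfl a b
      have h2 := D_mono _ y v hv' rfl (!a) b
      omega
  | swap a y =>
    intro v hv
    match v, hv with
    | b :: e :: v, hv =>
      have hv' : y.length = v.length := by simpa using hv
      have h1 := D_mono _ y v hv' rfl a b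
      have h2 := D_mono _ y v hv' rfl (!a) b
      have h3 := D_mono _ y v hv' rfl a e
      have h4 := D_mono _ y v hv' rfl (!a) e
      have h5 := D_cons_same e hv'
      revert h1 h2 h3 h4 h5
      cases a <;> cases b <;> cases e <;> simp [D] <;> omega
    | [b], hv => simp at hv
  | @cons a u w hs ih =>
    intro v hv
    match v, hv with
    | b :: v, hv =>
      have hv' : u.length = v.length := by simpa using hv
      have hl := S_len hs
      have ihv := ih v hv'
      by_cases hab : a = b
      · subst hab
        rw [D_cons_same _ hv', D_cons_same _ (hl ▸ hv')]
        exact ihv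
      · match u, w, v, hs, hv', hl, ih, ihv with
        | c :: u, c' :: w, e :: v, hs, hv', hl, ih, ihv =>
          have hu : u.length = v.length := by simpa using hv'
          have hw : w.length = v.length := by simp at hl; omega
          have m1 := D_mono _ u v hu rfl c e
          have m2 := D_mono _ w v hw rfl c' e
          simp only [D, hab, if_false]
          by_cases h1 : c = b ∧ e = a <;> by_cases h2 : c' = b ∧ e = a
          · rw [if_pos h1, if_pos h2]
            obtain ⟨rfl, rfl⟩ := h1
            obtain ⟨rfl, -⟩ := h2
            have := ih (c' :: v) (by simpa using hu)
            rw [D_cons_same _ hu, D_cons_same _ hw] at this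
            omega
          · rw [if_pos h1, if_neg h2]; omega
          · rw [if_neg h1, if_pos h2]
            obtain ⟨rfl, rfl⟩ := h2
            have hc : c = e := by
              cases c <;> cases e <;> cases c' <;> simp_all
            subst hc
            rw [D_cons_same _ hu]
            cases hs with
            | repl => omega
            | swap _ y =>
              match v, hu with
              | g :: v, hu =>
                have hv' : y.length = v.length := by simpa using hu
                have h1 := D_mono _ y v hv' rfl c g
                have h2 := D_mono _ y v hv' rfl (!c) g
                omega
            | cons => exact absurd rfl hab
          · rw [if_neg h1, if_neg h2]; omega
        | [], _, _, hs, _, _, _, _ => cases hs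


lemma reach_D_le : ∀ (h : ℕ) (u v : List Bool), reach TStep h u v →
    u.length = v.length ∧ D u v ≤ h := by
  intro h
  induction h with
  | zero => rintro u v rfl; exact ⟨rfl, (D_self u).le⟩
  | succ h ih =>
    rintro u v ⟨w, s, r⟩
    obtain ⟨h1, h2⟩ := ih w v r
    have hs := S_of s
    have hl := S_len hs
    have := D_lip hs v (hl.trans h1)
    exact ⟨hl.trans h1, by omega⟩

lemma tstep_cons (a : Bool) {u w : List Bool} (h : TStep u w) : TStep (a :: u) (a :: w) := by
  cases h with
  | repl x y b => exact TStep.repl (a :: x) y b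
  | swap x y b => exact TStep.swap (a :: x) y b

lemma tstep_append (p : List Bool) {u w : List Bool} (h : TStep u w) :
    TStep (p ++ u) (p ++ w) := by
  induction p with
  | nil => exact h
  | cons a p ih => exact tstep_cons a ih

lemma reach_cons (a : Bool) : ∀ (h : ℕ) (u v : List Bool), reach TStep h u v →
    reach TStep h (a :: u) (a :: v) := by
  intro h
  induction h with
  | zero => rintro u v rfl; rfl
  | succ h ih => rintro u v ⟨w, s, r⟩; exact ⟨_, tstep_cons a s, ih _ _ r⟩

lemma reach_D : ∀ (u v : List Bool), u.length = v.length → reach TStep (D u v) u v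
  | [], [], _ => rfl
  | [a], [b], _ => by
    by_cases hab : a = b
    · subst hab; simp [D, reach]
    · have : b = !a := by cases a <;> cases b <;> simp_all
      subst this
      simp only [D, hab, if_false]
      exact ⟨_, TStep.repl [] [] a, rfl⟩
  | a :: c :: u, b :: e :: v, h => by
    have h' : (c :: u).length = (e :: v).length := by simpa using h
    by_cases hab : a = b
    · subst hab
      rw [D_cons_same _ h']
      exact reach_cons a _ _ _ (reach_D _ _ h')
    · have : b = !a := by cases a <;> cases b <;> simp_all
      subst this
      simp only [D, hab, if_false]
      split_ifs with hc
      · obtain ⟨rfl, rfl⟩ := hc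
        rw [add_comm]
        exact ⟨_, TStep.swap [] u e, reach_cons _ _ _ _ (reach_cons _ _ _ _
          (reach_D u v (by simpa using h)))⟩
      · rw [add_comm]
        exact ⟨_, TStep.repl [] (c :: u) a, reach_cons _ _ _ _ (reach_D _ _ h')⟩

lemma tildeDist_eq {u v : List Bool} (h : u.length = v.length) : tildeDist u v = D u v := by
  apply le_antisymm
  · exact Nat.sInf_le (reach_D u v h)
  · have : reach TStep (tildeDist u v) u v := Nat.sInf_mem (s := {h | reach TStep h u v})
      ⟨_, reach_D u v h⟩
    exact (reach_D_le _ _ _ this).2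

lemma tildeDist_one_iff {u v : List Bool} : tildeDist u v = 1 ↔ TStep u v := by
  constructor
  · intro h
    have hne : {h | reach TStep h u v}.Nonempty := by
      by_contra hc
      rw [Set.not_nonempty_iff_eq_empty] at hc
      rw [tildeDist, hc] at h
      simp at h
    have : reach TStep (tildeDist u v) u v := Nat.sInf_mem hne
    rw [h] at this
    obtain ⟨w, s, rfl⟩ := this
    exact s
  · intro h
    have h1 : reach TStep 1 u v := ⟨v, h, rfl⟩
    have h2 : tildeDist u v ≤ 1 := Nat.sInf_le h1
    have h3 : tildeDist u v ≠ 0 := by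
      intro h0
      have : reach TStep (tildeDist u v) u v :=
        Nat.sInf_mem (s := {h | reach TStep h u v}) ⟨1, h1⟩
      rw [h0] at this
      exact S_ne (S_of h) this
    omega

/-! ### Positive part -/

lemma infix_split (a c : Bool) (x : List Bool) : ∀ p : List Bool,
    [a, a, a, c] <:+: p ++ (!a) :: x → [a, a, a, c] <:+: p ++ [!a] ∨ [a, a, a, c] <:+: x := by
  intro p
  induction p with
  | nil =>
    intro h
    rw [List.nil_append, List.infix_cons_iff] at h
    rcases h with h | h
    · simp at h
    · exact Or.inr h
  | cons b p ih =>
    intro h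
    rw [List.cons_append, List.infix_cons_iff] at h
    rcases h with h | h
    · left
      apply List.IsPrefix.isInfix
      match p, h with
      | [], h => simp at h
      | [_], h => simp at h
      | [_, _], h => simpa using h
      | _ :: _ :: _ :: _, h => simpa using h
    · rcases ih h with h | h
      · left
        rw [List.cons_append, List.infix_cons_iff]
        exact Or.inr h
      · exact Or.inr h

/-- one improving step on the left word -/
def Good (f p u v : List Bool) : Prop :=
  ∃ w, TStep u w ∧ w.length = v.length ∧ D w v + 1 = D u v ∧ ¬ f <:+: p ++ w

lemma D_symm {u v : List Bool} (h : u.length = v.length) : D u v = D v u := by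
  rw [← tildeDist_eq h, ← tildeDist_eq h.symm, tildeDist_comm]

lemma good_cons {f p u v : List Bool} (b : Bool) (hl : u.length = v.length)
    (h : Good f (p ++ [b]) u v) : Good f p (b :: u) (b :: v) := by
  obtain ⟨w, s, l, d, n⟩ := h
  refine ⟨b :: w, tstep_cons b s, by simpa using l, ?_, by simpa using n⟩
  rw [D_cons_same _ l, D_cons_same _ hl, d]

lemma good_head (a c : Bool) (p u v : List Bool) (hl : u.length = v.length)
    (hu : ¬ [a, a, a, c] <:+: p ++ a :: u) (hv : ¬ [a, a, a, c] <:+: p ++ (!a) :: v) :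
    Good [a, a, a, c] p (a :: u) ((!a) :: v) ∨ Good [a, a, a, c] p ((!a) :: v) (a :: u) := by
  have key : (∃ x y, u = (!a) :: x ∧ v = a :: y) ∨ D (a :: u) ((!a) :: v) = 1 + D u v := by
    match u, v, hl with
    | [], [], _ => right; simp [D]
    | d :: u, e :: v, _ =>
      by_cases h : d = (!a) ∧ e = a
      · left; exact ⟨u, v, by rw [h.1], by rw [h.2]⟩
      · right; simp [D, h]
  rcases key with ⟨x, y, rfl, rfl⟩ | key
  · right
    have hl' : x.length = y.length := by simpa using hl
    refine ⟨a :: (!a) :: y, ?_, by simpa using hl'.symm, ?_, ?_⟩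
    · simpa using TStep.swap [] y (!a)
    · rw [D_cons_same _ (by simp [hl']), D_cons_same _ hl'.symm]
      simp [D]; omega
    · intro h
      have h' : [a, a, a, c] <:+: (p ++ [a]) ++ (!a) :: y := by simpa using h
      rcases infix_split a c y _ h' with h1 | h1
      · exact hu (h1.trans ⟨[], x, by simp⟩)
      · exact hv (h1.trans ⟨p ++ [!a, a], [], by simp⟩)
  · left
    refine ⟨(!a) :: u, TStep.repl [] u a, by simpa using hl, ?_, ?_⟩
    · rw [D_cons_same _ hl, key]; omega
    · intro h
      rcases infix_split a c u _ h with h1 | h1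
      · exact hv (h1.trans ⟨[], v, by simp⟩)
      · exact hu (h1.trans ⟨p ++ [a], [], by simp⟩)

lemma good (a c : Bool) : ∀ (u v p : List Bool), u.length = v.length → u ≠ v →
    ¬ [a, a, a, c] <:+: p ++ u → ¬ [a, a, a, c] <:+: p ++ v →
    Good [a, a, a, c] p u v ∨ Good [a, a, a, c] p v u
  | [], [], _, _, hne, _, _ => absurd rfl hne
  | b :: u, d :: v, p, hl, hne, hu, hv => by
    have hl' : u.length = v.length := by simpa using hl
    by_cases hbd : b = d
    · subst hbd
      have := good a c u v (p ++ [b]) hl' (by rintro rfl; exact hne rfl)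
        (by simpa using hu) (by simpa using hv)
      exact this.imp (good_cons b hl') (good_cons b hl'.symm)
    · by_cases hb : b = a
      · subst hb
        have : d = !b := by cases b <;> cases d <;> simp_all
        subst this
        exact good_head b c p u v hl' hu hv
      · have h1 : b = !a := by cases b <;> cases a <;> simp_all
        have h2 : d = a := by
          clear hu hv hne hl h1
          revert hbd hb; cases b <;> cases d <;> cases a <;> decide
        subst h1 h2
        exact (good_head d c p v u hl'.symm hv hu).symm

/-- step between factor-free words -/
def FStep (f u v : List Bool) : Prop := TStep u v ∧ ¬ f <:+: u ∧ ¬ f <:+: v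

lemma reach_free (a c : Bool) : ∀ (n : ℕ) (u v : List Bool), u.length = v.length → D u v = n →
    ¬ [a, a, a, c] <:+: u → ¬ [a, a, a, c] <:+: v → reach (FStep [a, a, a, c]) n u v := by
  intro n
  induction n with
  | zero =>
    intro u v hl hd hu hv
    have := reach_D u v hl
    rw [hd] at this
    exact this
  | succ n ih =>
    intro u v hl hd hu hv
    have hne : u ≠ v := by rintro rfl; rw [D_self] at hd; omega
    rcases good a c u v [] hl hne hu hv with ⟨w, s, l, d, hw⟩ | ⟨w, s, l, d, hw⟩
    · exact ⟨w, ⟨s, hu, hw⟩, ih w v l (by omega) hw hv⟩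
    · have e : D u w = n := by
        rw [D_symm l.symm]; rw [D_symm hl.symm] at d; omega
      exact reach_snoc (ih u w l.symm e hu hw) ⟨s.symm, hw, hv⟩

lemma reach_fun {step : List Bool → List Bool → Prop} : ∀ (n : ℕ) (u v : List Bool),
    reach step n u v → ∃ w : ℕ → List Bool, w 0 = u ∧ w n = v ∧
      ∀ k < n, step (w k) (w (k + 1)) := by
  intro n
  induction n with
  | zero => rintro u v rfl; exact ⟨fun _ => u, rfl, rfl, by simp⟩
  | succ n ih =>
    rintro u v ⟨z, s, r⟩
    obtain ⟨w, h0, hn, hs⟩ := ih z v r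
    refine ⟨fun k => Nat.casesOn k u w, rfl, hn, ?_⟩
    intro k hk
    cases k with
    | zero => simpa [h0] using s
    | succ k => exact hs k (by omega)

lemma iso_pos (a c : Bool) : TildeIsometric [a, a, a, c] := by
  intro n _ u v hun hvn hu hv
  have hl : u.length = v.length := hun.trans hvn.symm
  obtain ⟨w, h0, hn, hs⟩ := reach_fun _ _ _ (reach_free a c _ u v hl rfl hu hv)
  rw [tildeDist_eq hl]
  refine ⟨w, h0, hn, fun k hk => tildeDist_one_iff.2 (hs k hk).1, fun k hk => ?_⟩
  rcases Nat.lt_or_eq_of_le hk with h | h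
  · exact (hs k h).2.1
  · rw [h, hn]; exact hv

/-! ### Symmetries -/

lemma tstep_reverse {u v : List Bool} (h : TStep u v) : TStep u.reverse v.reverse := by
  cases h with
  | repl x y a => simpa using TStep.repl y.reverse x.reverse a
  | swap x y a => simpa using TStep.swap y.reverse x.reverse (!a)

lemma tstep_map {u v : List Bool} (h : TStep u v) : TStep (u.map (!·)) (v.map (!·)) := by
  cases h with
  | repl x y a => simpa using TStep.repl (x.map (!·)) (y.map (!·)) (!a)
  | swap x y a => simpa using TStep.swap (x.map (!·)) (y.map (!·)) (!a)

lemma iso_sym (φ : List Bool → List Bool) (hφ : ∀ u, φ (φ u) = u)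
    (hlen : ∀ u, (φ u).length = u.length)
    (hst : ∀ u v, TStep u v → TStep (φ u) (φ v))
    (hin : ∀ f u : List Bool, f <:+: u → φ f <:+: φ u) (f : List Bool)
    (h : TildeIsometric f) : TildeIsometric (φ f) := by
  have hr : ∀ n u v, reach TStep n u v → reach TStep n (φ u) (φ v) := by
    intro n
    induction n with
    | zero => rintro u v rfl; rfl
    | succ n ih => rintro u v ⟨w, s, r⟩; exact ⟨_, hst _ _ s, ih _ _ r⟩
  have hd : ∀ u v, tildeDist (φ u) (φ v) = tildeDist u v := by
    intro u v
    unfold tildeDist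
    congr 1
    ext n
    refine ⟨fun r => ?_, fun r => hr _ _ _ r⟩
    have := hr _ _ _ r
    rwa [hφ, hφ] at this
  have hin' : ∀ f u : List Bool, φ f <:+: u → f <:+: φ u := by
    intro f u h
    have := hin _ _ h
    rwa [hφ] at this
  intro n hn u v hu hv fu fv
  obtain ⟨w, h0, h1, h2, h3⟩ := h n (by rwa [hlen] at hn) (φ u) (φ v) (by rw [hlen, hu])
    (by rw [hlen, hv]) (fun k => fu (by simpa [hφ] using hin _ _ k))
    (fun k => fv (by simpa [hφ] using hin _ _ k))
  rw [hd] at h1 h2 h3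
  refine ⟨fun k => φ (w k), by simp [h0, hφ], by simp [h1, hφ], ?_, ?_⟩
  · intro k hk
    simp only [hd]
    exact h2 k hk
  · intro k hk hc
    exact h3 k hk (by simpa [hφ] using hin' _ _ hc)

lemma iso_rev (f : List Bool) (h : TildeIsometric f) : TildeIsometric f.reverse :=
  iso_sym List.reverse (by simp) (by simp) (fun _ _ => tstep_reverse)
    (fun _ _ h => List.reverse_infix.2 h) f h

lemma iso_compl (f : List Bool) (h : TildeIsometric f) : TildeIsometric (f.map (!·)) :=
  iso_sym (List.map (!·)) (by simp [Function.comp_def]) (by simp) (fun _ _ => tstep_map)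
    (fun _ _ h => h.map _) f h

/-! ### Negative part -/

/-- All words one step away. -/
def nbrs : List Bool → List (List Bool)
  | [] => []
  | [a] => [[!a]]
  | a :: b :: u => ((!a) :: b :: u) :: (b :: a :: u) :: (nbrs (b :: u)).map (a :: ·)

lemma mem_nbrs {u w : List Bool} (h : S u w) : w ∈ nbrs u := by
  induction h with
  | repl a y => cases y <;> simp [nbrs]
  | swap a y => simp [nbrs]
  | @cons a u w hs ih =>
    match u, hs, ih with
    | b :: u, hs, ih => simp [nbrs, ih]

lemma not_iso (f u v : List Bool) (h1 : f.length ≤ u.length) (hl : u.length = v.length)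
    (hu : ¬ f <:+: u) (hv : ¬ f <:+: v) (hd : D u v = 2)
    (hn : ∀ w ∈ nbrs u, f <:+: w ∨ v ∉ nbrs w) : ¬ TildeIsometric f := by
  intro h
  obtain ⟨w, w0, w1, w2, w3⟩ := h _ h1 u v rfl hl.symm hu hv
  rw [tildeDist_eq hl, hd] at w1 w2 w3
  have s0 := mem_nbrs (S_of (tildeDist_one_iff.1 (w2 0 (by omega))))
  have s1 := mem_nbrs (S_of (tildeDist_one_iff.1 (w2 1 (by omega))))
  rw [w0] at s0
  rw [w1] at s1
  rcases hn _ s0 with k | k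
  · exact w3 1 (by omega) k
  · exact k s1

lemma n1100 : ¬ TildeIsometric [true, true, false, false] :=
  not_iso _ [true, false, true, false, true, false] [true, true, false, true, false, false]
    (by decide) (by decide) (by decide) (by decide) (by decide) (by decide)

lemma n1010 : ¬ TildeIsometric [true, false, true, false] :=
  not_iso _ [false, true, true, false, false] [true, false, false, true, false]
    (by decide) (by decide) (by decide) (by decide) (by decide) (by decide)

lemma n1001 : ¬ TildeIsometric [true, false, false, true] :=
  not_iso _ [false, true, false, true, false] [true, false, false, false, true]
    (by decide) (by decide) (by decide) (by decide) (by decide) (by decide)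

lemma n1011 : ¬ TildeIsometric [true, false, true, true] :=
  not_iso _ [false, true, true, true, true] [true, false, false, true, true]
    (by decide) (by decide) (by decide) (by decide) (by decide) (by decide)

lemma neg_all (g : List Bool) (h : ¬ TildeIsometric g) :
    ¬ TildeIsometric g ∧ ¬ TildeIsometric (g.map (!·)) ∧
        ¬ TildeIsometric g.reverse ∧ ¬ TildeIsometric (g.map (!·)).reverse := by
  have hc : ¬ TildeIsometric (g.map (!·)) := fun k => h (by
    have := iso_compl _ k
    simpa [Function.comp_def] using this)
  refine ⟨h, hc, fun k => h (by simpa using iso_rev _ k), fun k => hc ?_⟩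
  have := iso_rev _ k
  rwa [List.reverse_reverse] at this

end TI

/-- A binary word of length `4` is tilde-isometric iff it is one of
`1111, 1110, 1000, 0000, 0001, 0111`; in particular `1100, 1010, 1001, 1011`
and their complements and reverses are tilde-non-isometric. -/
theorem tildeIsometric_length_four_iff :
    (∀ f : List Bool, f.length = 4 →
      (TildeIsometric f ↔
        f ∈ [[true, true, true, true], [true, true, true, false],
             [true, false, false, false], [false, false, false, false],
             [false, false, false, true], [false, true, true, true]])) ∧
    (∀ g ∈ [[true, true, false, false], [true, false, true, false],
            [true, false, false, true], [true, false, true, true]],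
      ¬ TildeIsometric g ∧ ¬ TildeIsometric (g.map (!·)) ∧
        ¬ TildeIsometric g.reverse ∧ ¬ TildeIsometric (g.map (!·)).reverse) := by
  have N := fun g h => TI.neg_all g h
  have a1 := N _ TI.n1100
  have a2 := N _ TI.n1010
  have a3 := N _ TI.n1001
  have a4 := N _ TI.n1011
  refine ⟨?_, ?_⟩
  · intro f hf
    have r1 := TI.iso_rev _ (TI.iso_pos false true)
    have r2 := TI.iso_rev _ (TI.iso_pos true false)
    have q := TI.iso_pos
    have q1 := q true true
    have q2 := q true false
    have q3 := q false true
    have q4 := q false false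
    clear q N
    simp only [List.map_cons, List.map_nil, Bool.not_true, Bool.not_false, List.reverse_cons,
      List.reverse_nil, List.nil_append, List.cons_append] at a1 a2 a3 a4 r1 r2
    match f, hf with
    | [a, b, c, d], _ =>
      cases a <;> cases b <;> cases c <;> cases d <;> simp [*]
  · intro g hg
    simp only [List.mem_cons, List.not_mem_nil, or_false] at hg
    rcases hg with rfl | rfl | rfl | rfl
    · exact a1
    · exact a2
    · exact a3
    · exact a4
end

section
/- For all n ≥ 2, the number of edges of the tilde-Fibonacci cube satisfies 5·|E(F̃_n)| = (n+1)·f_{n+3} + (n−2)·f_{n+1} (and |E(F̃_1)| = 1). -/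
namespace TFC

inductive D : List Bool → List Bool → Prop
  | r (y : List Bool) : D (false :: y) (true :: y)
  | s (y : List Bool) : D (false :: true :: y) (true :: false :: y)
  | c (a : Bool) (u v : List Bool) : D u v → D (a :: u) (a :: v)

theorem D.length {u v : List Bool} (h : D u v) : u.length = v.length := by
  induction h <;> simp_all

theorem D.asymm {u v : List Bool} (h : D u v) : ¬ D v u := by
  induction h with
  | r y => intro h; cases h
  | s y => intro h; cases h
  | c a u v h ih =>
    intro h'
    generalize hu : a :: u = p at h'
    generalize hv : a :: v = q at h'
    cases h' <;> simp_all

theorem D_nil (v : List Bool) : ¬ D [] v := by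
  intro h; cases h

theorem D_nil' (v : List Bool) : ¬ D v [] := by
  intro h; cases h

theorem D_same (a : Bool) (u v : List Bool) : D (a :: u) (a :: v) ↔ D u v := by
  constructor
  · intro h
    generalize hu : a :: u = p at h
    generalize hv : a :: v = q at h
    cases h <;> simp_all
  · exact D.c a u v

theorem D_tf (u v : List Bool) : ¬ D (true :: u) (false :: v) := by
  intro h; cases h

theorem D_ft (u v : List Bool) : D (false :: u) (true :: v) ↔
    u = v ∨ ∃ y, u = true :: y ∧ v = false :: y := by
  constructor
  · intro h
    cases h
    · left; rfl
    · right; exact ⟨_, rfl, rfl⟩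
  · rintro (rfl | ⟨y, rfl, rfl⟩)
    · exact D.r _
    · exact D.s _

theorem TStep_cons (a : Bool) {u v : List Bool} (h : TStep u v) : TStep (a :: u) (a :: v) := by
  cases h with
  | repl x y b => exact TStep.repl (a :: x) y b
  | swap x y b => exact TStep.swap (a :: x) y b

theorem D.tstep {u v : List Bool} (h : D u v) : TStep u v := by
  induction h with
  | r y => exact TStep.repl [] y false
  | s y => exact TStep.swap [] y false
  | c a u v h ih => exact TStep_cons a ih

theorem D_app (x : List Bool) {u v : List Bool} (h : D u v) : D (x ++ u) (x ++ v) := by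
  induction x with
  | nil => exact h
  | cons a x ih => exact D.c a _ _ ih

theorem tstep_iff (u v : List Bool) : TStep u v ↔ D u v ∨ D v u := by
  constructor
  · intro h
    cases h with
    | repl x y a =>
      cases a
      · exact Or.inl (D_app x (D.r y))
      · exact Or.inr (D_app x (D.r y))
    | swap x y a =>
      cases a
      · exact Or.inl (D_app x (D.s y))
      · exact Or.inr (D_app x (D.s y))
  · rintro (h | h)
    · exact h.tstep
    · exact h.tstep.symm

theorem D_irrefl (u : List Bool) : ¬ D u u := fun h => h.asymm h

theorem reach_one (u v : List Bool) : reach TStep 1 u v ↔ TStep u v := by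
  constructor
  · rintro ⟨w, h, rfl⟩; exact h
  · intro h; exact ⟨v, h, rfl⟩

theorem dist_one_iff (u v : List Bool) : tildeDist u v = 1 ↔ D u v ∨ D v u := by
  rw [← tstep_iff, ← reach_one]
  constructor
  · intro h
    have hne : {h | reach TStep h u v}.Nonempty := by
      apply Nat.nonempty_of_pos_sInf
      unfold tildeDist at h
      omega
    have := Nat.sInf_mem hne
    unfold tildeDist at h
    rw [h] at this
    exact this
  · intro h
    have h1 : tildeDist u v ≤ 1 := Nat.sInf_le h
    have h0 : tildeDist u v ≠ 0 := by
      intro h0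
      have hm := Nat.sInf_mem (s := {h | reach TStep h u v}) ⟨1, h⟩
      unfold tildeDist at h0
      rw [h0] at hm
      have : u = v := hm
      subst this
      rw [reach_one, tstep_iff] at h
      exact D_irrefl u (by tauto)
    omega

def Fr (w : List Bool) : Prop := ¬ [true, true] <:+: w

theorem Fr_nil : Fr [] := by simp [Fr]
theorem Fr_f (w : List Bool) : Fr (false :: w) ↔ Fr w := by
  simp [Fr, List.infix_cons_iff]
theorem Fr_t1 : Fr [true] := by simp [Fr, List.infix_cons_iff]
theorem Fr_tf (w : List Bool) : Fr (true :: false :: w) ↔ Fr w := by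
  simp [Fr, List.infix_cons_iff]
theorem Fr_tt (w : List Bool) : ¬ Fr (true :: true :: w) := by
  simp [Fr, List.infix_cons_iff]

theorem Fr_t (w : List Bool) (h : Fr (true :: w)) : Fr w := by
  intro h'
  exact h (List.infix_cons_iff.2 (Or.inr h'))

def W : ℕ → Finset (List Bool)
  | 0 => {[]}
  | 1 => {[false], [true]}
  | n + 2 => (W (n + 1)).image (fun w => false :: w) ∪ (W n).image (fun w => true :: false :: w)

def Z : ℕ → Finset (List Bool)
  | 0 => {[]}
  | n + 1 => (W n).image (fun w => false :: w)

def E : ℕ → Finset (List Bool × List Bool)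
  | 0 => ∅
  | 1 => {([false], [true])}
  | n + 2 => (((E (n + 1)).image (fun p => (false :: p.1, false :: p.2)) ∪
      (E n).image (fun p => (true :: false :: p.1, true :: false :: p.2))) ∪
      (W n).image (fun w => (false :: false :: w, true :: false :: w))) ∪
      (Z n).image (fun w => (false :: true :: w, true :: false :: w))

theorem mem_W : ∀ (n : ℕ) (w : List Bool), w ∈ W n ↔ w.length = n ∧ Fr w
  | 0, w => by
    cases w <;> simp [W, Fr_nil]
  | 1, w => by
    rcases w with _ | ⟨a, _ | ⟨b, w⟩⟩
    · simp [W]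
    · cases a <;> simp [W, Fr_f, Fr_nil, Fr_t1]
    · simp [W]
  | n + 2, w => by
    have h1 := mem_W (n + 1)
    have h2 := mem_W n
    rcases w with _ | ⟨a, _ | ⟨b, w⟩⟩
    · simp [W]
    · simp [W, h1]
    · cases a <;> cases b <;> simp [W, h1, h2, Fr_f, Fr_tf, Fr_tt]

theorem mem_Z (n : ℕ) (w : List Bool) : w ∈ Z n ↔ w.length = n ∧ Fr (true :: w) := by
  cases n with
  | zero => cases w <;> simp [Z, Fr_t1]
  | succ n =>
    rcases w with _ | ⟨b, w⟩
    · simp [Z]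
    · cases b <;> simp [Z, mem_W, Fr_tf, Fr_tt]

theorem mem_E : ∀ (n : ℕ) (u v : List Bool), (u, v) ∈ E n ↔
    u.length = n ∧ v.length = n ∧ Fr u ∧ Fr v ∧ D u v
  | 0, u, v => by
    cases u <;> cases v <;> simp [E, D_nil]
  | 1, u, v => by
    rcases u with _ | ⟨a, _ | ⟨b, u⟩⟩
    · simp [E]
    · rcases v with _ | ⟨a', _ | ⟨b', v⟩⟩
      · simp [E]
      · cases a <;> cases a' <;> simp [E, Fr_f, Fr_nil, Fr_t1, D_irrefl, D_tf, D.r]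
      · simp [E]
    · simp [E]
  | n + 2, u, v => by
    have h1 := mem_E (n + 1)
    have h2 := mem_E n
    rcases u with _ | ⟨a, _ | ⟨b, u⟩⟩
    · simp [E]
    · simp [E, h1]
    · rcases v with _ | ⟨a', _ | ⟨b', v⟩⟩
      · simp [E]
      · simp [E, h1]
      · cases a <;> cases a' <;> cases b <;> cases b' <;>
          simp [E, h1, h2, mem_W, mem_Z, Fr_f, Fr_tf, Fr_tt, D_same, D_tf, D_ft] <;> grind [Fr_t]

theorem card_W : ∀ n : ℕ, (W n).card = Nat.fib (n + 2)
  | 0 => by simp [W]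
  | 1 => by simp [W, Nat.fib]
  | n + 2 => by
    have h1 := card_W (n + 1)
    have h2 := card_W n
    rw [W, Finset.card_union_of_disjoint, Finset.card_image_of_injective,
      Finset.card_image_of_injective, h1, h2, Nat.fib_add_two (n := n + 2), add_comm]
    · intro a b; simp
    · intro a b; simp
    · rw [Finset.disjoint_left]; simp

theorem card_Z (n : ℕ) : (Z n).card = Nat.fib (n + 1) := by
  cases n with
  | zero => simp [Z]
  | succ n =>
    rw [Z, Finset.card_image_of_injective, card_W]
    intro a b; simp

theorem card_E (n : ℕ) : (E (n + 2)).card =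
    (E (n + 1)).card + (E n).card + Nat.fib (n + 3) := by
  rw [E, Finset.card_union_of_disjoint, Finset.card_union_of_disjoint,
    Finset.card_union_of_disjoint, Finset.card_image_of_injective,
    Finset.card_image_of_injective, Finset.card_image_of_injective,
    Finset.card_image_of_injective, card_W, card_Z, Nat.fib_add_two (n := n + 1)]
  · ring
  · intro a b; simp
  · intro a b; simp
  · rintro ⟨a, b⟩ ⟨c, d⟩; simp
  · rintro ⟨a, b⟩ ⟨c, d⟩; simp
  · rw [Finset.disjoint_left]; simp; grind
  · rw [Finset.disjoint_left]; simp; grind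
  · rw [Finset.disjoint_left]; simp; grind

theorem formula : ∀ n : ℕ, (5 * (E n).card : ℤ) =
    (n + 1) * Nat.fib (n + 3) + (n - 2) * Nat.fib (n + 1)
  | 0 => by simp [E, Nat.fib]
  | 1 => by simp [E, Nat.fib]
  | n + 2 => by
    have h1 := formula (n + 1)
    have h2 := formula n
    have e1 : Nat.fib (n + 3) = Nat.fib (n + 1) + Nat.fib (n + 2) := Nat.fib_add_two
    have e2 : Nat.fib (n + 4) = Nat.fib (n + 2) + Nat.fib (n + 3) := Nat.fib_add_two
    have e3 : Nat.fib (n + 5) = Nat.fib (n + 3) + Nat.fib (n + 4) := Nat.fib_add_two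
    rw [card_E]
    simp only [show n + 1 + 3 = n + 4 from rfl, show n + 1 + 1 = n + 2 from rfl,
      show n + 2 + 3 = n + 5 from rfl, show n + 2 + 1 = n + 3 from rfl] at *
    rw [e3, e2, e1]
    rw [e2, e1] at h1
    rw [e1] at h2
    push_cast at *
    linear_combination h1 + h2

def toEdge (n : ℕ) (p : E n) : (tildeFibCube n).edgeSet :=
  have h := (mem_E n p.1.1 p.1.2).1 p.2
  ⟨s(⟨⟨p.1.1, h.1⟩, h.2.2.1⟩, ⟨⟨p.1.2, h.2.1⟩, h.2.2.2.1⟩),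
    (dist_one_iff _ _).2 (Or.inl h.2.2.2.2)⟩

theorem toEdge_bij (n : ℕ) : Function.Bijective (toEdge n) := by
  constructor
  · rintro ⟨⟨a, b⟩, h⟩ ⟨⟨c, d⟩, h'⟩ he
    have h1 := ((mem_E n a b).1 h).2.2.2.2
    have h2 := ((mem_E n c d).1 h').2.2.2.2
    have he := Sym2.eq_iff.1 (congrArg Subtype.val he)
    rcases he with ⟨e1, e2⟩ | ⟨e1, e2⟩
    · have k1 : a = c := congrArg (fun x => x.1.1) e1
      have k2 : b = d := congrArg (fun x => x.1.1) e2
      subst k1 k2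
      rfl
    · have k1 : a = d := congrArg (fun x => x.1.1) e1
      have k2 : b = c := congrArg (fun x => x.1.1) e2
      subst k1 k2
      exact absurd h2 h1.asymm
  · rintro ⟨e, he⟩
    induction e using Sym2.ind with
    | _ u v =>
      have hd : tildeDist u.1.1 v.1.1 = 1 := he
      rcases (dist_one_iff _ _).1 hd with h | h
      · exact ⟨⟨(u.1.1, v.1.1), (mem_E n _ _).2 ⟨u.1.2, v.1.2, u.2, v.2, h⟩⟩, rfl⟩
      · exact ⟨⟨(v.1.1, u.1.1), (mem_E n _ _).2 ⟨v.1.2, u.1.2, v.2, u.2, h⟩⟩,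
          Subtype.ext Sym2.eq_swap⟩

theorem card_edge (n : ℕ) : Nat.card (tildeFibCube n).edgeSet = (E n).card := by
  rw [← Nat.card_eq_of_bijective _ (toEdge_bij n)]
  simp

end TFC

/-- Closed formula for the number of edges of the tilde-Fibonacci cube. -/
theorem tildeFibCube_edge_count :
    Nat.card (tildeFibCube 1).edgeSet = 1 ∧
    ∀ n : ℕ, 2 ≤ n →
      5 * Nat.card (tildeFibCube n).edgeSet =
        (n + 1) * Nat.fib (n + 3) + (n - 2) * Nat.fib (n + 1) := by
  refine ⟨by rw [TFC.card_edge]; rfl, ?_⟩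
  intro n hn
  rw [TFC.card_edge]
  have h := TFC.formula n
  obtain ⟨m, rfl⟩ := Nat.exists_eq_add_of_le' hn
  zify [hn]
  exact_mod_cast h
end

section
/- The number of edges of the Fibonacci cube satisfies |E(F_1)| = 1, |E(F_2)| = 2, |E(F_n)| = |E(F_{n-1})| + |E(F_{n-2})| + f_n for all n > 2, and in closed form 5·|E(F_n)| = 2(n+1)·f_n + n·f_{n+1} for all n ≥ 1. -/
def FF : ℕ → Finset (List Bool)
  | 0 => {[]}
  | 1 => {[false], [true]}
  | n + 2 => (FF (n + 1)).image (List.cons false) ∪ (FF n).image (fun v => true :: false :: v)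

theorem mem_FF : ∀ (n : ℕ) (w : List Bool), w ∈ FF n ↔ w.length = n ∧ ¬ [true, true] <:+: w
  | 0, w => by
    simp only [FF, Finset.mem_singleton, List.length_eq_zero_iff]
    constructor
    · rintro rfl; simp
    · exact fun h => h.1
  | 1, w => by
    simp only [FF, Finset.mem_insert, Finset.mem_singleton, List.length_eq_one_iff]
    constructor
    · rintro (rfl | rfl)
      · exact ⟨⟨_, rfl⟩, by decide⟩
      · exact ⟨⟨_, rfl⟩, by decide⟩
    · rintro ⟨⟨a, rfl⟩, -⟩; cases a <;> simp
  | n + 2, w => by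
    simp only [FF, Finset.mem_union, Finset.mem_image, mem_FF (n + 1), mem_FF n]
    constructor
    · rintro (⟨v, ⟨h1, h2⟩, rfl⟩ | ⟨v, ⟨h1, h2⟩, rfl⟩)
      · simp [List.infix_cons_iff, h1, h2]
      · simp [List.infix_cons_iff, h1, h2]
    · rintro ⟨h1, h2⟩
      match w, h1, h2 with
      | false :: v, h1, h2 =>
        left
        refine ⟨v, ⟨by simpa using h1, ?_⟩, rfl⟩
        intro h; exact h2 (List.infix_cons_iff.2 (Or.inr h))
      | true :: false :: v, h1, h2 =>
        right
        refine ⟨v, ⟨by simpa using h1, ?_⟩, rfl⟩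
        intro h; exact h2 (List.infix_cons_iff.2 (Or.inr (List.infix_cons_iff.2 (Or.inr h))))
      | true :: true :: v, h1, h2 =>
        exact absurd ⟨[], v, rfl⟩ h2

theorem FF_sum (n : ℕ) (g : List Bool → ℕ) :
    ∑ w ∈ FF (n + 2), g w = ∑ v ∈ FF (n + 1), g (false :: v) + ∑ v ∈ FF n, g (true :: false :: v) := by
  rw [FF, Finset.sum_union, Finset.sum_image, Finset.sum_image]
  · intro a _ b _ h; simpa using h
  · intro a _ b _ h; simpa using h
  · rw [Finset.disjoint_left]
    intro a h1 h2
    simp only [Finset.mem_image] at h1 h2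
    obtain ⟨v, _, rfl⟩ := h1
    obtain ⟨w, _, h⟩ := h2
    simp at h

theorem FF_card : ∀ n, (FF n).card = Nat.fib (n + 2)
  | 0 => rfl
  | 1 => rfl
  | n + 2 => by
    have := FF_sum n (fun _ => 1)
    simp only [Finset.sum_const, smul_eq_mul, mul_one] at this
    rw [this, FF_card (n + 1), FF_card n, Nat.fib_add_two (n := n + 2)]
    ring_nf

theorem hd_cons (a b : Bool) (u v : List Bool) :
    hammDist (a :: u) (b :: v) = (if a = b then 0 else 1) + hammDist u v := by
  cases a <;> cases b <;> simp [hammDist, List.filter_cons, add_comm]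

theorem hd_zero : ∀ u v : List Bool, u.length = v.length → (hammDist u v = 0 ↔ u = v)
  | [], [], _ => by simp [hammDist]
  | a :: u, b :: v, h => by
    have := hd_zero u v (by simpa using h)
    rw [hd_cons]
    split_ifs with hab <;> simp [hab, this]

def DD (n : ℕ) : ℕ := ∑ u ∈ FF n, ∑ v ∈ FF n, if hammDist u v = 1 then 1 else 0

theorem cross (n : ℕ) :
    ∑ v ∈ FF n, ∑ u ∈ FF (n + 1), (if hammDist (true :: false :: v) (false :: u) = 1 then 1 else 0)
      = (FF n).card := by
  rw [Finset.card_eq_sum_ones]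
  refine Finset.sum_congr rfl fun v hv => ?_
  have hv' := (mem_FF _ _).1 hv
  rw [Finset.sum_eq_single (false :: v)]
  · simp [hd_cons, hammDist_self]
  · intro u hu hne
    have hu' := (mem_FF _ _).1 hu
    rw [if_neg]
    rw [hd_cons]
    have := hd_zero (false :: v) u (by simp [hu'.1, hv'.1])
    simp only [Bool.true_eq_false, if_false]
    intro h
    exact hne (this.1 (by omega)).symm
  · intro h
    exact absurd ((mem_FF _ _).2 ⟨by simp [hv'.1], by simp [List.infix_cons_iff, hv'.2]⟩) h

theorem DD_rec (n : ℕ) : DD (n + 2) = DD (n + 1) + DD n + 2 * Nat.fib (n + 2) := by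
  have h1 := cross n
  have h2 : ∑ u ∈ FF (n + 1), ∑ v ∈ FF n,
      (if hammDist (false :: u) (true :: false :: v) = 1 then 1 else 0) = (FF n).card := by
    rw [Finset.sum_comm, ← h1]
    simp only [hammDist_comm]
  rw [FF_card] at h1 h2
  rw [DD, FF_sum]
  simp only [FF_sum, Finset.sum_add_distrib]
  rw [h1, h2]
  simp only [hd_cons, if_true, zero_add, DD]
  ring

theorem two_card (n : ℕ) : 2 * Nat.card (fibCube n).edgeSet = DD n := by
  classical
  let e : fibFree n ≃ {w // w ∈ FF n} :=
    { toFun := fun w => ⟨w.1.1, (mem_FF _ _).2 ⟨w.1.2, w.2⟩⟩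
      invFun := fun w => ⟨⟨w.1, ((mem_FF _ _).1 w.2).1⟩, ((mem_FF _ _).1 w.2).2⟩
      left_inv := fun _ => rfl
      right_inv := fun _ => rfl }
  letI : Fintype (fibFree n) := Fintype.ofEquiv _ e.symm
  have key : ∀ g : List Bool → ℕ, ∑ w : fibFree n, g w.1.1 = ∑ w ∈ FF n, g w := by
    intro g
    rw [← Finset.sum_coe_sort (FF n)]
    exact Fintype.sum_equiv e _ _ (fun _ => rfl)
  rw [Nat.card_eq_fintype_card, ← SimpleGraph.edgeFinset_card,
    ← SimpleGraph.sum_degrees_eq_twice_card_edges, DD, ← key]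
  refine Finset.sum_congr rfl fun u _ => ?_
  rw [← key, ← SimpleGraph.card_neighborFinset_eq_degree, SimpleGraph.neighborFinset_eq_filter,
    Finset.card_filter]
  refine Finset.sum_congr rfl fun w _ => ?_
  have h : (fibCube n).Adj u w ↔ hammDist u.1.1 w.1.1 = 1 := Iff.rfl
  simp only [h]

theorem E_rec (n : ℕ) : Nat.card (fibCube (n + 2)).edgeSet =
    Nat.card (fibCube (n + 1)).edgeSet + Nat.card (fibCube n).edgeSet + Nat.fib (n + 2) := by
  have := DD_rec n
  rw [← two_card, ← two_card, ← two_card] at this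
  omega

theorem E_zero : Nat.card (fibCube 0).edgeSet = 0 := by
  have := two_card 0
  have h : DD 0 = 0 := by decide
  omega

theorem E_one : Nat.card (fibCube 1).edgeSet = 1 := by
  have := two_card 1
  have h : DD 1 = 2 := by decide
  omega

theorem E_closed : ∀ n : ℕ,
    5 * Nat.card (fibCube n).edgeSet = 2 * (n + 1) * Nat.fib n + n * Nat.fib (n + 1)
  | 0 => by rw [E_zero]; simp
  | 1 => by rw [E_one]; simp
  | n + 2 => by
    have h1 := E_closed (n + 1)
    have h2 := E_closed n
    rw [E_rec, mul_add, mul_add, h1, h2]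
    have e1 : Nat.fib (n + 2 + 1) = Nat.fib (n + 1) + Nat.fib (n + 2) := Nat.fib_add_two
    have e2 : Nat.fib (n + 2) = Nat.fib n + Nat.fib (n + 1) := Nat.fib_add_two
    rw [show n + 1 + 1 = n + 2 from rfl, e1, e2]
    push_cast
    ring

/-- Recurrence and closed formula for the number of edges of the Fibonacci cube. -/
theorem fibCube_edge_count :
    Nat.card (fibCube 1).edgeSet = 1 ∧
    Nat.card (fibCube 2).edgeSet = 2 ∧
    (∀ n : ℕ, 2 < n →
      Nat.card (fibCube n).edgeSet =
        Nat.card (fibCube (n - 1)).edgeSet + Nat.card (fibCube (n - 2)).edgeSet + Nat.fib n) ∧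
    (∀ n : ℕ, 1 ≤ n →
      5 * Nat.card (fibCube n).edgeSet = 2 * (n + 1) * Nat.fib n + n * Nat.fib (n + 1)) := by
  refine ⟨E_one, ?_, ?_, fun n _ => E_closed n⟩
  · rw [E_rec 0, E_zero, E_one]; rfl
  · intro n hn
    obtain ⟨m, rfl⟩ : ∃ m, n = m + 2 := ⟨n - 2, by omega⟩
    exact E_rec m
end
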